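/- Run HPMD with 1 + η_k·τ_k = 1/γ and η_k = γ^{−2(k+1)}, and assume |c(s,a)| ≤ C for all (s,a). Then for every k ≥ K₁ := 3·log_γ( Δ*(M)·(1−γ) / (2ϱ·(4·log|A| + C)) ) (where log_γ x = log x / log γ): dist_{ℓ1}(π_{k+1}, Π*) ≤ 2·C_γ·|A|·exp( −Δ*(M)·γ^{−2k−1}/2 ), where C_γ = exp( 2C / ((1−γ³)(1−γ)γ) ). -/

import Mathlib

/-- A probability distribution on a finite set: nonnegative and sums to 1. -/
def IsDist {A : Type*} [Fintype A] (p : A → ℝ) : Prop :=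
  (∀ a, 0 ≤ p a) ∧ ∑ a, p a = 1

/-- A (randomized, stationary) policy. -/
def IsPolicy {S A : Type*} [Fintype A] (π : S → A → ℝ) : Prop :=
  ∀ s, IsDist (π s)

/-- Kullback–Leibler divergence on a finite set (0·log 0 = 0). -/
noncomputable def KL {A : Type*} [Fintype A] (p q : A → ℝ) : ℝ :=
  ∑ a, p a * Real.log (p a / q a)

/-- The Q-function induced by a value function `V`. -/
noncomputable def Qf {S A : Type*} [Fintype S] (γ : ℝ) (c : S → A → ℝ)
    (P : S → A → S → ℝ) (V : S → ℝ) (s : S) (a : A) : ℝ :=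
  c s a + γ * ∑ s', P s a s' * V s'

/-- Minimal Q-value at a state. -/
noncomputable def Qmin {S A : Type*} [Fintype A] [Nonempty A] (Q : S → A → ℝ) (s : S) : ℝ :=
  Finset.univ.inf' Finset.univ_nonempty (Q s)

/-- Optimality of a policy, relative to the value function `V`. -/
def IsOptPolicy {S A : Type*} [Fintype A] (V : (S → A → ℝ) → S → ℝ) (π : S → A → ℝ) : Prop :=
  IsPolicy π ∧ ∀ π', IsPolicy π' → ∀ s, V π s ≤ V π' s

/-- The ℓ₁ distance of a policy to the set of optimal policies:
dist_{ℓ1}(π, Π*) = max_s inf_{π'∈Π*} Σ_a |π(a|s) − π'(a|s)|. -/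
noncomputable def distL1 {S A : Type*} [Fintype S] [Nonempty S] [Fintype A]
    (V : (S → A → ℝ) → S → ℝ) (π : S → A → ℝ) : ℝ :=
  Finset.univ.sup' Finset.univ_nonempty
    (fun s => sInf {x : ℝ | ∃ π', IsOptPolicy V π' ∧ x = ∑ a, |π s a - π' s a|})


section Distributions

open Finset

variable {A : Type*} [Fintype A]

lemma IsDist.sum_mul_le {p : A → ℝ} (hp : IsDist p) {f : A → ℝ} {M : ℝ} (hf : ∀ a, f a ≤ M) :
    ∑ a, p a * f a ≤ M := by
  calc ∑ a, p a * f a ≤ ∑ a, p a * M :=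
        sum_le_sum fun a _ => mul_le_mul_of_nonneg_left (hf a) (hp.1 a)
    _ = M := by rw [← sum_mul, hp.2, one_mul]

lemma IsDist.le_sum_mul {p : A → ℝ} (hp : IsDist p) {f : A → ℝ} {M : ℝ} (hf : ∀ a, M ≤ f a) :
    M ≤ ∑ a, p a * f a := by
  calc M = ∑ a, p a * M := by rw [← sum_mul, hp.2, one_mul]
    _ ≤ ∑ a, p a * f a :=
        sum_le_sum fun a _ => mul_le_mul_of_nonneg_left (hf a) (hp.1 a)

lemma IsDist.le_one {p : A → ℝ} (hp : IsDist p) (a : A) : p a ≤ 1 :=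
  hp.2 ▸ single_le_sum (fun b _ => hp.1 b) (mem_univ a)

lemma mul_klFun_div {x y : ℝ} (hy : 0 < y) :
    y * InformationTheory.klFun (x / y) = x * Real.log (x / y) + y - x := by
  unfold InformationTheory.klFun
  field_simp

lemma KL_eq_sum_klFun {p q : A → ℝ} (hp : IsDist p) (hq : IsDist q) (hpos : ∀ a, 0 < q a) :
    KL p q = ∑ a, q a * InformationTheory.klFun (p a / q a) := by
  simp_rw [fun a => mul_klFun_div (x := p a) (hpos a), sum_sub_distrib, sum_add_distrib]
  rw [hp.2, hq.2, KL]
  ring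

lemma KL_nonneg {p q : A → ℝ} (hp : IsDist p) (hq : IsDist q) (hpos : ∀ a, 0 < q a) :
    0 ≤ KL p q := by
  rw [KL_eq_sum_klFun hp hq hpos]
  exact sum_nonneg fun a _ => mul_nonneg (hpos a).le
    (InformationTheory.klFun_nonneg (div_nonneg (hp.1 a) (hpos a).le))

lemma eq_of_KL_nonpos {p q : A → ℝ} (hp : IsDist p) (hq : IsDist q) (hpos : ∀ a, 0 < q a)
    (h : KL p q ≤ 0) (a : A) : p a = q a := by
  have hn : ∀ b ∈ univ, 0 ≤ q b * InformationTheory.klFun (p b / q b) := fun b _ =>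
    mul_nonneg (hpos b).le
      (InformationTheory.klFun_nonneg (div_nonneg (hp.1 b) (hpos b).le))
  rw [KL_eq_sum_klFun hp hq hpos] at h
  have h0 := (sum_eq_zero_iff_of_nonneg hn).1 (le_antisymm h (sum_nonneg hn)) a (mem_univ a)
  have h1 := (mul_eq_zero.1 h0).resolve_left (hpos a).ne'
  rw [InformationTheory.klFun_eq_zero_iff (div_nonneg (hp.1 a) (hpos a).le)] at h1
  exact (div_eq_one_iff_eq (hpos a).ne').1 h1

lemma KL_eq_sub {p q : A → ℝ} (hpos : ∀ a, 0 < q a) :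
    KL p q = ∑ a, p a * Real.log (p a) - ∑ a, p a * Real.log (q a) := by
  rw [KL, ← sum_sub_distrib]
  refine sum_congr rfl fun a _ => ?_
  by_cases h : p a = 0
  · simp [h]
  · rw [Real.log_div h (hpos a).ne']
    ring

lemma KL_uniform_le_log_card [Nonempty A] {p u : A → ℝ} (hp : IsDist p)
    (hu : ∀ a, u a = 1 / (Fintype.card A : ℝ)) :
    KL p u ≤ Real.log (Fintype.card A : ℝ) := by
  have hcard : (0 : ℝ) < Fintype.card A := by exact_mod_cast Fintype.card_pos
  rw [KL_eq_sub fun a => by rw [hu]; positivity]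
  simp_rw [hu, one_div, Real.log_inv]
  rw [← sum_mul, hp.2]
  have : ∑ a, p a * Real.log (p a) ≤ 0 := sum_nonpos fun a _ =>
    mul_nonpos_of_nonneg_of_nonpos (hp.1 a) (Real.log_nonpos (hp.1 a) (hp.le_one a))
  linarith

/-- If `log r` differs from `γ (log q - η Q)` by a constant, then the mirror descent objective at
`p` exceeds `KL p r / γ` by an amount that does not depend on `p`. -/
lemma objective_eq [Nonempty A] {γ η τ b : ℝ} (hγ : 0 < γ) (hpar : 1 + η * τ = 1 / γ)
    {Q q u r : A → ℝ} (hu : ∀ a, u a = 1 / (Fintype.card A : ℝ)) (hq : ∀ a, 0 < q a)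
    (hr : ∀ a, 0 < r a)
    (hlog : ∀ a, Real.log (r a) = γ * Real.log (q a) - γ * η * Q a + b)
    {p : A → ℝ} (hp : IsDist p) :
    η * ((∑ a, Q a * p a) + τ * KL p u) + KL p q =
      1 / γ * KL p r + (b / γ + η * τ * Real.log (Fintype.card A : ℝ)) := by
  have hcard : (0 : ℝ) < Fintype.card A := by exact_mod_cast Fintype.card_pos
  rw [KL_eq_sub hq, KL_eq_sub hr, KL_eq_sub fun a => by rw [hu]; positivity]
  have h1 : ∑ a, p a * Real.log (u a) = - Real.log (Fintype.card A : ℝ) := by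
    simp_rw [hu, one_div, Real.log_inv]
    rw [← sum_mul, hp.2, one_mul]
  have h2 : ∑ a, p a * Real.log (r a) =
      γ * ∑ a, p a * Real.log (q a) - γ * η * ∑ a, Q a * p a + b := by
    have h3 : ∀ a, p a * Real.log (r a) =
        γ * (p a * Real.log (q a)) - γ * η * (Q a * p a) + p a * b := fun a => by
      rw [hlog]; ring
    simp_rw [h3, sum_add_distrib, sum_sub_distrib, ← mul_sum, ← sum_mul, hp.2, one_mul]
  rw [h1, h2]
  have h4 : η * τ = 1 / γ - 1 := by linarith
  have h5 : ∀ x y z : ℝ, η * (x + τ * (y - -z)) = η * x + η * τ * (y + z) := fun x y z => by ring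
  rw [h5, h4]
  field_simp
  ring

/-- The minimizer of the mirror descent objective is a Gibbs distribution, and the objective obeys
a three-point identity. -/
lemma minimizer_spec [Nonempty A] {γ η τ : ℝ} (hγ : 0 < γ) (hpar : 1 + η * τ = 1 / γ)
    {Q q u r : A → ℝ} (hu : ∀ a, u a = 1 / (Fintype.card A : ℝ)) (hq : ∀ a, 0 < q a)
    (hrd : IsDist r)
    (hmin : ∀ p, IsDist p → η * ((∑ a, Q a * r a) + τ * KL r u) + KL r q ≤
      η * ((∑ a, Q a * p a) + τ * KL p u) + KL p q) :
    (∀ a, 0 < r a) ∧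
    (∀ a a', Real.log (r a) - Real.log (r a') =
      γ * (Real.log (q a) - Real.log (q a')) - γ * η * (Q a - Q a')) ∧
    ∀ p, IsDist p → η * ((∑ a, Q a * p a) + τ * KL p u) + KL p q =
      η * ((∑ a, Q a * r a) + τ * KL r u) + KL r q + 1 / γ * KL p r := by
  set g : A → ℝ := fun a => γ * Real.log (q a) - γ * η * Q a with hg
  set Z : ℝ := ∑ a, Real.exp (g a) with hZ
  have hZpos : 0 < Z := sum_pos (fun a _ => Real.exp_pos _) univ_nonempty
  set w : A → ℝ := fun a => Real.exp (g a) / Z with hw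
  have hwpos : ∀ a, 0 < w a := fun a => div_pos (Real.exp_pos _) hZpos
  have hwd : IsDist w := ⟨fun a => (hwpos a).le, by
    simp only [hw]; rw [← sum_div]; exact div_self hZpos.ne'⟩
  have hwlog : ∀ a, Real.log (w a) = γ * Real.log (q a) - γ * η * Q a + -Real.log Z := fun a => by
    simp only [hw]
    rw [Real.log_div (Real.exp_pos _).ne' hZpos.ne', Real.log_exp]
    ring
  have hself : KL w w = 0 := by rw [KL_eq_sub hwpos, sub_self]
  have hle := hmin w hwd
  rw [objective_eq hγ hpar hu hq hwpos hwlog hrd, objective_eq hγ hpar hu hq hwpos hwlog hwd,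
    hself] at hle
  have hKL : KL r w ≤ 0 := by
    have : 1 / γ * KL r w ≤ 0 := by linarith
    by_contra hcon
    have := mul_pos (one_div_pos.2 hγ) (not_le.1 hcon)
    linarith
  obtain rfl : r = w := funext (eq_of_KL_nonpos hrd hwd hwpos hKL)
  refine ⟨hwpos, fun a a' => by rw [hwlog, hwlog]; ring, fun p hp => ?_⟩
  rw [objective_eq hγ hpar hu hq hwpos hwlog hp, objective_eq hγ hpar hu hq hwpos hwlog hwd, hself]
  ring

/-- A distribution is within twice its non-greedy mass of a distribution supported on the greedy
actions. -/
lemma exists_dist_supported {G : A → Prop} {a₀ : A} (ha₀ : G a₀) {p : A → ℝ} (hp : IsDist p)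
    {B : ℝ} (hB : 0 ≤ B) (hpB : ∀ a, ¬ G a → p a ≤ B) :
    ∃ r : A → ℝ, IsDist r ∧ (∀ a, r a ≠ 0 → G a) ∧
      ∑ a, |p a - r a| ≤ 2 * (Fintype.card A * B) := by
  classical
  set m : ℝ := ∑ a, if G a then 0 else p a with hm
  have hm0 : 0 ≤ m := sum_nonneg fun a _ => by split_ifs; exacts [le_rfl, hp.1 a]
  have hmB : m ≤ Fintype.card A * B := by
    calc m ≤ ∑ _a : A, B := sum_le_sum fun a _ => by
            split_ifs with h
            exacts [hB, hpB a h]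
      _ = Fintype.card A * B := by simp
  refine ⟨fun a => (if G a then p a else 0) + if a = a₀ then m else 0, ⟨fun a => ?_, ?_⟩, ?_, ?_⟩
  · have := hp.1 a
    positivity
  · rw [sum_add_distrib, hm, sum_ite_eq' univ a₀]
    simp only [mem_univ, if_true]
    rw [← sum_add_distrib, ← hp.2]
    exact sum_congr rfl fun a _ => by split_ifs <;> simp
  · intro a ha
    by_contra hG
    have : a ≠ a₀ := fun h => hG (h ▸ ha₀)
    simp [hG, this] at ha
  · calc ∑ a, |p a - ((if G a then p a else 0) + if a = a₀ then m else 0)|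
        ≤ ∑ a, ((if G a then 0 else p a) + if a = a₀ then m else 0) := by
          refine sum_le_sum fun a _ => ?_
          have := hp.1 a
          rw [abs_le]
          split_ifs <;> constructor <;> linarith
      _ = 2 * m := by
          rw [sum_add_distrib, ← hm, sum_ite_eq' univ a₀]
          simp only [mem_univ, if_true]
          ring
      _ ≤ _ := by linarith

end Distributions

section Discounted

open Finset

variable {S A : Type*} [Fintype S]

/-- Maximum principle for discounted averages. -/
lemma le_of_le_discounted [Nonempty S] [Fintype A] {γ ε : ℝ} (h0 : 0 ≤ γ) (h1 : γ < 1)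
    {P : S → A → S → ℝ} (hP : ∀ s a, IsDist (P s a)) {p : S → A → ℝ} (hp : IsPolicy p)
    {u : S → ℝ} (hu : ∀ s, u s ≤ ε + γ * ∑ a, p s a * ∑ s', P s a s' * u s') (s : S) :
    u s ≤ ε / (1 - γ) := by
  obtain ⟨t, ht⟩ := Finite.exists_max u
  have h2 : ∑ a, p t a * ∑ s', P t a s' * u s' ≤ u t :=
    (hp t).sum_mul_le fun a => (hP t a).sum_mul_le ht
  have h3 := hu t
  have h4 := mul_le_mul_of_nonneg_left h2 h0
  refine (ht s).trans ?_
  rw [le_div_iff₀ (by linarith)]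
  linarith

lemma Qf_sub_Qf {γ : ℝ} {c : S → A → ℝ} {P : S → A → S → ℝ} (V W : S → ℝ) (s : S) (a : A) :
    Qf γ c P V s a - Qf γ c P W s a = γ * ∑ s', P s a s' * (V s' - W s') := by
  simp only [Qf, mul_sub, sum_sub_distrib]
  ring

lemma sum_mul_Qf [Fintype A] {γ : ℝ} {c : S → A → ℝ} {P : S → A → S → ℝ} (V : S → ℝ)
    (p : A → ℝ) (s : S) :
    ∑ a, p a * Qf γ c P V s a =
      ∑ a, p a * c s a + γ * ∑ a, p a * ∑ s', P s a s' * V s' := by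
  simp only [Qf, mul_add, sum_add_distrib, mul_sum]
  congr 1
  exact sum_congr rfl fun a _ => sum_congr rfl fun t _ => by ring

lemma sum_mul_Qf_sub [Fintype A] {γ : ℝ} {c : S → A → ℝ} {P : S → A → S → ℝ} (V W : S → ℝ)
    (p : A → ℝ) (s : S) :
    ∑ a, p a * Qf γ c P V s a - ∑ a, p a * Qf γ c P W s a =
      γ * ∑ a, p a * ∑ s', P s a s' * (V s' - W s') := by
  rw [← sum_sub_distrib, mul_sum]
  refine sum_congr rfl fun a _ => ?_
  rw [← mul_sub, Qf_sub_Qf]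
  ring

lemma abs_value_le [Nonempty S] [Fintype A] {γ C : ℝ} (h0 : 0 ≤ γ) (h1 : γ < 1) {c : S → A → ℝ}
    (hC : ∀ s a, |c s a| ≤ C) {P : S → A → S → ℝ} (hP : ∀ s a, IsDist (P s a))
    {p : S → A → ℝ} (hp : IsPolicy p) {W : S → ℝ}
    (hW : ∀ s, W s = ∑ a, p s a * Qf γ c P W s a) (s : S) : |W s| ≤ C / (1 - γ) := by
  rw [abs_le']
  constructor
  · refine le_of_le_discounted h0 h1 hP hp (fun s => ?_) s
    have h2 := (hp s).sum_mul_le fun a => (abs_le.1 (hC s a)).2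
    have h3 := hW s
    rw [sum_mul_Qf] at h3
    linarith
  · refine le_of_le_discounted h0 h1 hP hp (u := fun s => - W s) (fun s => ?_) s
    have h2 := (hp s).le_sum_mul fun a => (abs_le.1 (hC s a)).1
    have h3 := hW s
    rw [sum_mul_Qf] at h3
    simp only [mul_neg, sum_neg_distrib]
    linarith

lemma abs_Qf_le {γ C : ℝ} (h0 : 0 ≤ γ) (h1 : γ < 1) {c : S → A → ℝ}
    (hC : ∀ s a, |c s a| ≤ C) {P : S → A → S → ℝ} (hP : ∀ s a, IsDist (P s a))
    {W : S → ℝ} (hW : ∀ s, |W s| ≤ C / (1 - γ)) (s : S) (a : A) :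
    |Qf γ c P W s a| ≤ C / (1 - γ) := by
  have h2 := (hP s a).sum_mul_le fun t => (abs_le.1 (hW t)).2
  have h3 := (hP s a).le_sum_mul fun t => (abs_le.1 (hW t)).1
  have h4 := abs_le.1 (hC s a)
  have h5 : C / (1 - γ) = C + γ * (C / (1 - γ)) := by
    field_simp [(sub_pos.2 h1).ne']
    ring
  have h6 := mul_le_mul_of_nonneg_left h2 h0
  have h7 := mul_le_mul_of_nonneg_left h3 h0
  rw [abs_le, Qf]
  constructor <;> linarith

/-- A policy supported on actions greedy for the optimal `Q`-function is optimal. -/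
lemma isOptPolicy_of_greedy [Nonempty S] [Fintype A] [Nonempty A] {γ : ℝ} (h0 : 0 ≤ γ)
    (h1 : γ < 1) {c : S → A → ℝ} {P : S → A → S → ℝ} (hP : ∀ s a, IsDist (P s a)) {V : (S → A → ℝ) → S → ℝ}
    (hV : ∀ π, IsPolicy π → ∀ s, V π s = ∑ a, π s a * Qf γ c P (V π) s a)
    {πstar : S → A → ℝ} (hπstar : IsOptPolicy V πstar) {p : S → A → ℝ} (hp : IsPolicy p)
    (hgreedy : ∀ s a, p s a ≠ 0 →
      Qf γ c P (V πstar) s a = Qmin (Qf γ c P (V πstar)) s) :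
    IsOptPolicy V p := by
  refine ⟨hp, fun p' hp' s => le_trans ?_ (hπstar.2 p' hp' s)⟩
  have hle : ∀ s, V p s - V πstar s ≤ 0 / (1 - γ) := by
    refine le_of_le_discounted h0 h1 hP hp fun s => ?_
    have h2 : ∑ a, p s a * Qf γ c P (V πstar) s a = Qmin (Qf γ c P (V πstar)) s := by
      rw [← one_mul (Qmin _ s), ← (hp s).2, sum_mul]
      refine sum_congr rfl fun a _ => ?_
      by_cases h : p s a = 0
      · simp [h]
      · rw [hgreedy s a h]
    have h3 : Qmin (Qf γ c P (V πstar)) s ≤ V πstar s := by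
      rw [hV πstar hπstar.1 s]
      exact (hπstar.1 s).le_sum_mul fun a => inf'_le _ (mem_univ a)
    have h4 := sum_mul_Qf_sub (γ := γ) (c := c) (P := P) (V p) (V πstar) (p s) s
    rw [← hV p hp s] at h4
    linarith
  have := hle s
  rw [zero_div] at this
  linarith

end Discounted

section Recursions

lemma neg_le_of_recursion {γ M : ℝ} (h0 : 0 < γ) (h1 : γ < 1) {D R : ℕ → ℝ}
    (hD : ∀ i, -M ≤ D i) (hR0 : R 0 = 0) (hM : 0 ≤ M)
    (hR : ∀ i, R (i + 1) = γ * R i + γ ^ (-(2 * (i : ℤ) + 1)) * D i) (i : ℕ) :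
    -(M * γ ^ (1 - 2 * (i : ℤ)) / (1 - γ ^ 3)) ≤ R i := by
  have h3 : 0 < 1 - γ ^ 3 := sub_pos.2 (pow_lt_one₀ h0.le h1 three_ne_zero)
  induction i with
  | zero =>
    rw [hR0, neg_nonpos]
    positivity
  | succ i ih =>
    rw [hR]
    have hw : 0 < γ ^ (-(2 * (i : ℤ) + 1)) := zpow_pos h0 _
    have e1 : γ ^ (1 - 2 * ((i + 1 : ℕ) : ℤ)) = γ ^ (-(2 * (i : ℤ) + 1)) := by
      rw [show 1 - 2 * ((i + 1 : ℕ) : ℤ) = -(2 * (i : ℤ) + 1) by push_cast; ring]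
    have e2 : γ * γ ^ (1 - 2 * (i : ℤ)) = γ ^ (-(2 * (i : ℤ) + 1)) * γ ^ 3 := by
      rw [← zpow_one_add₀ h0.ne', ← zpow_natCast γ 3, ← zpow_add₀ h0.ne']
      congr 1; push_cast; ring
    have e3 := mul_le_mul_of_nonneg_left ih h0.le
    have e4 := mul_le_mul_of_nonneg_left (hD i) hw.le
    have e5 : γ * -(M * γ ^ (1 - 2 * (i : ℤ)) / (1 - γ ^ 3)) =
        -(M * (γ ^ (-(2 * (i : ℤ) + 1)) * γ ^ 3) / (1 - γ ^ 3)) := by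
      rw [← e2]; ring
    rw [e5] at e3
    rw [e1]
    have e6 : M * γ ^ (-(2 * (i : ℤ) + 1)) / (1 - γ ^ 3) =
        M * (γ ^ (-(2 * (i : ℤ) + 1)) * γ ^ 3) / (1 - γ ^ 3) + γ ^ (-(2 * (i : ℤ) + 1)) * M := by
      field_simp
      ring
    linarith

lemma pow_mul_le_of_recursion {γ : ℝ} (h0 : 0 < γ) {D R : ℕ → ℝ} {N : ℕ}
    (hD : ∀ i, N ≤ i → 0 ≤ D i)
    (hR : ∀ i, R (i + 1) = γ * R i + γ ^ (-(2 * (i : ℤ) + 1)) * D i) (n : ℕ) :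
    γ ^ n * R N ≤ R (N + n) := by
  induction n with
  | zero => simp
  | succ n ih =>
    rw [← add_assoc, hR, pow_succ']
    have e1 := mul_le_mul_of_nonneg_left ih h0.le
    have e2 := mul_nonneg (zpow_pos h0 (-(2 * ((N + n : ℕ) : ℤ) + 1))).le
      (hD (N + n) (Nat.le_add_right _ _))
    linarith

/-- Lower bound for the accumulated log-ratio between a greedy and a non-greedy action. -/
lemma log_ratio_lower_bound {γ θ H C : ℝ} {k : ℕ} (h0 : 0 < γ) (h1 : γ < 1) (hH : 0 < H)
    (hθ : 0 < θ) (hC : 0 ≤ C) (hgap : 2 * θ * H ≤ 2 * C / (1 - γ)) (hk : γ ^ k ≤ θ ^ 3)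
    {D R : ℕ → ℝ} (hDmid : ∀ i, H * (2 * θ - 1) ≤ D i)
    (hDlin : ∀ i, 2 * H * (θ - γ ^ i) ≤ D i) (hDneg : ∀ i, -(2 * C / (1 - γ)) ≤ D i)
    (hR0 : R 0 = 0) (hR : ∀ i, R (i + 1) = γ * R i + γ ^ (-(2 * (i : ℤ) + 1)) * D i) :
    γ ^ (-(2 * (k : ℤ) + 1)) * (θ * H) - 2 * C / ((1 - γ ^ 3) * (1 - γ) * γ) ≤ R (k + 1) := by
  have h1' : 0 < 1 - γ := sub_pos.2 h1
  have h3 : 0 < 1 - γ ^ 3 := sub_pos.2 (pow_lt_one₀ h0.le h1 three_ne_zero)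
  have hw : 0 < γ ^ (-(2 * (k : ℤ) + 1)) := zpow_pos h0 _
  rw [hR]
  by_cases hDk : θ * H ≤ D k
  · have e1 := mul_le_mul_of_nonneg_left hDk hw.le
    have hG : 0 ≤ 2 * C / ((1 - γ ^ 3) * (1 - γ) * γ) := by positivity
    suffices -(2 * C / ((1 - γ ^ 3) * (1 - γ) * γ)) ≤ γ * R k by linarith
    rcases Nat.eq_zero_or_pos k with rfl | hkpos
    · rw [hR0, mul_zero]
      linarith
    obtain ⟨n, hn⟩ := Nat.exists_eq_add_of_le (show k / 3 + 1 ≤ k by omega)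
    set N := k / 3 + 1 with hN
    have hDN : ∀ i, N ≤ i → 0 ≤ D i := fun i hi => by
      refine le_trans ?_ (hDlin i)
      have : γ ^ i ≤ θ := by
        refine le_of_pow_le_pow_left₀ three_ne_zero hθ.le (le_trans ?_ hk)
        rw [← pow_mul]
        exact pow_le_pow_of_le_one h0.le h1.le (by omega)
      have := sub_nonneg.2 this
      positivity
    have hM : 0 ≤ 2 * C / (1 - γ) := by positivity
    have e2 := neg_le_of_recursion h0 h1 hDneg hR0 hM hR N
    have e3 := pow_mul_le_of_recursion h0 hDN hR n
    rw [← hn] at e3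
    have e4 := mul_le_mul_of_nonneg_left e2 (pow_pos h0 n).le
    have e5 : γ * (γ ^ n * γ ^ (1 - 2 * (N : ℤ))) ≤ γ⁻¹ := by
      rw [← zpow_natCast γ n, ← zpow_add₀ h0.ne', ← zpow_one_add₀ h0.ne', ← zpow_neg_one]
      exact zpow_le_zpow_right_of_le_one₀ h0 h1.le (by omega)
    have e6 := mul_le_mul_of_nonneg_left (e4.trans e3) h0.le
    refine le_trans ?_ e6
    have e7 := mul_le_mul_of_nonneg_left e5 (div_nonneg hM h3.le)
    have e8 : 2 * C / ((1 - γ ^ 3) * (1 - γ) * γ) = 2 * C / (1 - γ) / (1 - γ ^ 3) * γ⁻¹ := by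
      field_simp
    rw [e8]
    refine (neg_le_neg e7).trans_eq ?_
    ring
  · set q := γ ^ k with hq
    have hqpos : 0 < q := pow_pos h0 k
    have e1 : H * (2 * θ - 2 * q) < θ * H := by linarith [hDlin k]
    have e2 : θ < 2 * q := by nlinarith
    have e3 : 1 < 2 * θ ^ 2 := by
      by_contra hcon
      have : θ * (2 * θ ^ 2) ≤ θ * 1 := mul_le_mul_of_nonneg_left (not_lt.1 hcon) hθ.le
      nlinarith
    have e4 : 1 < 2 * θ := by nlinarith
    have hD0 : ∀ i, 0 ≤ D i := fun i =>
      (mul_nonneg hH.le (by linarith)).trans (hDmid i)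
    have e5 := pow_mul_le_of_recursion (N := 0) h0 (fun i _ => hD0 i) hR k
    rw [hR0, mul_zero, zero_add] at e5
    have e6 : 2 * q - θ ≤ 2 * θ * q ^ 2 := by
      have : 0 ≤ θ * (2 * θ * q ^ 2 + θ - 2 * q) := by nlinarith [sq_nonneg (2 * θ * q - 1)]
      have := nonneg_of_mul_nonneg_right this hθ
      linarith
    have e7 : γ ^ (-(2 * (k : ℤ) + 1)) = (q ^ 2 * γ)⁻¹ := by
      rw [zpow_neg, zpow_add_one₀ h0.ne', hq, ← pow_mul, ← zpow_natCast γ (k * 2)]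
      congr 3
      push_cast; ring
    have e8 : 2 * θ * H / γ ≤ 2 * C / ((1 - γ ^ 3) * (1 - γ) * γ) := by
      have e9 : 2 * C / ((1 - γ ^ 3) * (1 - γ) * γ) = 2 * C / (1 - γ) / (1 - γ ^ 3) / γ := by
        field_simp
      rw [e9]
      refine div_le_div_of_nonneg_right (hgap.trans ?_) h0.le
      rw [le_div_iff₀ h3]
      have : 0 ≤ 2 * C / (1 - γ) := by positivity
      nlinarith [pow_pos h0 3]
    have e10 : (q ^ 2 * γ)⁻¹ * (θ * H) - 2 * θ * H / γ ≤ (q ^ 2 * γ)⁻¹ * D k := by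
      have e11 : (q ^ 2 * γ)⁻¹ * (θ * H) - 2 * θ * H / γ =
          (q ^ 2 * γ)⁻¹ * (θ * H - 2 * θ * H * q ^ 2) := by
        field_simp
      rw [e11]
      refine mul_le_mul_of_nonneg_left (le_trans ?_ (hDlin k)) (by positivity)
      nlinarith
    rw [e7]
    have := mul_nonneg h0.le e5
    linarith

lemma linear_decay_of_recursion {γ L : ℝ} (h0 : 0 < γ) (h1 : γ < 1) {F K : ℕ → ℝ}
    (hK : ∀ k, 0 ≤ K k)
    (hF : ∀ k, F (k + 1) ≤ γ * F k + γ ^ (2 * k + 1) * L + γ ^ (2 * k + 2) * K k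
      - γ ^ (2 * k + 1) * K (k + 1)) (k : ℕ) :
    F k + γ ^ (2 * k + 1) * K k ≤
      γ ^ k * (F 0 + γ * K 0 + L * ((1 - γ ^ k) / (1 - γ))) := by
  have h1' : 1 - γ ≠ 0 := (sub_pos.2 h1).ne'
  induction k with
  | zero => simp
  | succ k ih =>
    have e1 := hF k
    have e2 : γ ^ (2 * (k + 1) + 1) * K (k + 1) ≤ γ ^ (2 * k + 1) * K (k + 1) :=
      mul_le_mul_of_nonneg_right (pow_le_pow_of_le_one h0.le h1.le (by omega)) (hK _)
    have e3 := mul_le_mul_of_nonneg_left ih h0.le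
    have e4 : γ ^ (k + 1) * (F 0 + γ * K 0 + L * ((1 - γ ^ (k + 1)) / (1 - γ))) =
        γ * (γ ^ k * (F 0 + γ * K 0 + L * ((1 - γ ^ k) / (1 - γ)))) + γ ^ (2 * k + 1) * L := by
      field_simp
      ring
    have e5 : γ * (F k + γ ^ (2 * k + 1) * K k) = γ * F k + γ ^ (2 * k + 2) * K k := by ring
    linarith

end Recursions

section ValueConvergence

open Finset

variable {S A : Type*} [Fintype S] [Fintype A]

/-- One step of homotopic policy mirror descent, compared with an arbitrary distribution at each
state. -/
lemma value_step_le [Nonempty S] {γ η τ L : ℝ} (h0 : 0 < γ) (h1 : γ < 1) (hη : 0 < η) (hτ : 0 ≤ τ)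
    {c : S → A → ℝ} {P : S → A → S → ℝ} (hP : ∀ s a, IsDist (P s a)) {u p r : S → A → ℝ}
    (hu : ∀ s, IsDist (u s)) (hupos : ∀ s a, 0 < u s a)
    (huL : ∀ s x, IsDist x → KL x (u s) ≤ L)
    (hp : IsPolicy p) (hr : IsPolicy r) (hppos : ∀ s a, 0 < p s a) (hrpos : ∀ s a, 0 < r s a)
    {W W' : S → ℝ} (hW : ∀ s, W s = ∑ a, p s a * Qf γ c P W s a)
    (hW' : ∀ s, W' s = ∑ a, r s a * Qf γ c P W' s a)
    (hthree : ∀ s x, IsDist x →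
      η * ((∑ a, Qf γ c P W s a * x a) + τ * KL x (u s)) + KL x (p s) =
        η * ((∑ a, Qf γ c P W s a * r s a) + τ * KL (r s) (u s)) + KL (r s) (p s)
          + 1 / γ * KL x (r s))
    (s : S) {x : A → ℝ} (hx : IsDist x) :
    W' s ≤ ∑ a, x a * Qf γ c P W s a + τ * L / (1 - γ) + 1 / η * KL x (p s)
      - 1 / (η * γ) * KL x (r s) := by
  have hprox : ∀ s x, IsDist x → ∑ a, r s a * Qf γ c P W s a ≤
      ∑ a, x a * Qf γ c P W s a + τ * L + 1 / η * KL x (p s) - 1 / (η * γ) * KL x (r s) := by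
    intro s x hx
    have e1 := hthree s x hx
    simp_rw [mul_comm (Qf γ c P W s _)] at e1
    have e2 := mul_le_mul_of_nonneg_left (huL s x hx) hτ
    have e3 := mul_nonneg hτ (KL_nonneg (hr s) (hu s) (hupos s))
    have e4 := KL_nonneg (hr s) (hp s) (hppos s)
    have e5 : ∑ a, r s a * Qf γ c P W s a + τ * KL (r s) (u s) + 1 / η * KL (r s) (p s) =
        ∑ a, x a * Qf γ c P W s a + τ * KL x (u s) + 1 / η * KL x (p s)
          - 1 / (η * γ) * KL x (r s) := by
      field_simp
      field_simp at e1
      linarith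
    have e6 := mul_nonneg (one_div_pos.2 hη).le e4
    linarith
  have hmono : ∀ s, W' s - W s ≤ τ * L / (1 - γ) := by
    refine le_of_le_discounted h0.le h1 hP hr fun s => ?_
    have e1 := hprox s (p s) (hp s)
    have e2 : KL (p s) (p s) = 0 := by rw [KL_eq_sub (hppos s), sub_self]
    have e3 := mul_nonneg (one_div_pos.2 (mul_pos hη h0)).le
      (KL_nonneg (hp s) (hr s) (hrpos s))
    have e4 := sum_mul_Qf_sub (γ := γ) (c := c) (P := P) W' W (r s) s
    rw [← hW' s] at e4
    rw [e2, ← hW s] at e1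
    linarith
  have e1 := hprox s x hx
  have e2 := sum_mul_Qf_sub (γ := γ) (c := c) (P := P) W' W (r s) s
  rw [← hW' s] at e2
  have e3 : ∑ a, r s a * ∑ s', P s a s' * (W' s' - W s') ≤ τ * L / (1 - γ) :=
    (hr s).sum_mul_le fun a => (hP s a).sum_mul_le hmono
  have e4 := mul_le_mul_of_nonneg_left e3 h0.le
  have e5 : τ * L / (1 - γ) = τ * L + γ * (τ * L / (1 - γ)) := by
    field_simp [(sub_pos.2 h1).ne']
    ring
  linarith

/-- Averaging a successor expectation over a stationary distribution. -/
lemma stationary_average {P : S → A → S → ℝ} {ν : S → ℝ} {p : S → A → ℝ}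
    (hν : ∀ s', ν s' = ∑ s, ν s * ∑ a, p s a * P s a s') (f : S → ℝ) :
    ∑ s, ν s * ∑ a, p s a * ∑ s', P s a s' * f s' = ∑ s, ν s * f s := by
  have h : ∀ s, ν s * ∑ a, p s a * ∑ s', P s a s' * f s' =
      ∑ s', (ν s * ∑ a, p s a * P s a s') * f s' := fun s => by
    simp_rw [mul_sum, sum_mul]
    rw [sum_comm]
    exact sum_congr rfl fun _ _ => sum_congr rfl fun _ _ => by ring
  simp_rw [h]
  rw [sum_comm]
  simp_rw [← sum_mul, ← hν]

end ValueConvergence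

/-- local superlinear convergence of the policy for linearly converging HPMD
(Theorem 3). -/
theorem stmt9 {S A : Type*} [Fintype S] [Nonempty S] [Fintype A] [Nonempty A]
    (γ : ℝ) (hγ : 0 < γ ∧ γ < 1)
    (C : ℝ) (c : S → A → ℝ) (hC : ∀ s a, |c s a| ≤ C)
    (P : S → A → S → ℝ) (hP : ∀ s a, IsDist (P s a))
    (V : (S → A → ℝ) → S → ℝ)
    (hV : ∀ π, IsPolicy π → ∀ s, V π s = ∑ a, π s a * Qf γ c P (V π) s a)
    (πstar : S → A → ℝ) (hπstar : IsPolicy πstar)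
    (hoptimal : ∀ π', IsPolicy π' → ∀ s, V πstar s ≤ V π' s)
    (ν : S → ℝ) (hν : IsDist ν) (hνpos : ∀ s, 0 < ν s)
    (hνstat : ∀ s', ν s' = ∑ s, ν s * ∑ a, πstar s a * P s a s')
    -- Q* = Q^{π*}
    (Qst : S → A → ℝ) (hQst : Qst = Qf γ c P (V πstar))
    -- the distribution mismatch ratio ϱ = γ·max_{s,a,s'} P(s'|s,a)/ν*(s')
    (ϱ : ℝ)
    (hϱ : ϱ = γ * Finset.univ.sup' Finset.univ_nonempty
        (fun x : S × A × S => P x.1 x.2.1 x.2.2 / ν x.2.2))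
    -- the gap value Δ*(M): the minimum of Q*(s,a) − min_{a'} Q*(s,a') over suboptimal (s,a)
    (Δ : ℝ)
    (hΔlb : ∀ s a, Qst s a ≠ Qmin Qst s → Δ ≤ Qst s a - Qmin Qst s)
    (hΔmem : ∃ s a, Qst s a ≠ Qmin Qst s ∧ Δ = Qst s a - Qmin Qst s)
    -- HPMD parameters: 1 + η_k τ_k = 1/γ and η_k = γ^{−2(k+1)}
    (η τ : ℕ → ℝ)
    (hparam : ∀ k, 1 + η k * τ k = 1 / γ)
    (hηdef : ∀ k, η k = γ ^ (-(2 * ((k : ℤ) + 1))))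
    -- HPMD iterates
    (π : ℕ → S → A → ℝ) (hpol : ∀ k, IsPolicy (π k))
    (hinit : ∀ s a, π 0 s a = 1 / (Fintype.card A : ℝ))
    (hstep : ∀ k s, ∀ p : A → ℝ, IsDist p →
      η k * ((∑ a, Qf γ c P (V (π k)) s a * π (k+1) s a) + τ k * KL (π (k+1) s) (π 0 s))
          + KL (π (k+1) s) (π k s) ≤
      η k * ((∑ a, Qf γ c P (V (π k)) s a * p a) + τ k * KL p (π 0 s)) + KL p (π k s)) :
    ∀ k : ℕ,
      3 * (Real.log (Δ * (1 - γ) / (2 * ϱ * (4 * Real.log (Fintype.card A : ℝ) + C)))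
            / Real.log γ) ≤ (k : ℝ) →
      distL1 V (π (k+1)) ≤
        2 * Real.exp (2 * C / ((1 - γ ^ 3) * (1 - γ) * γ)) * (Fintype.card A : ℝ) *
          Real.exp (-(Δ * γ ^ (-(2 * (k : ℤ) + 1)) / 2)) := by
  obtain ⟨h0, h1⟩ := hγ
  subst hQst
  have h1' : 0 < 1 - γ := sub_pos.2 h1
  set L : ℝ := Real.log (Fintype.card A : ℝ) with hLdef
  set B : ℝ := C / (1 - γ) with hBdef
  have hopt : IsOptPolicy V πstar := ⟨hπstar, hoptimal⟩
  have hC0 : 0 ≤ C := (abs_nonneg _).trans (hC (Classical.arbitrary S) (Classical.arbitrary A))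
  have hcard : (0 : ℝ) < Fintype.card A := by exact_mod_cast Fintype.card_pos
  have hVB : ∀ p, IsPolicy p → ∀ s, |V p s| ≤ B := fun p hp =>
    abs_value_le h0.le h1 hC hP hp (hV p hp)
  have hQB : ∀ p, IsPolicy p → ∀ s a, |Qf γ c P (V p) s a| ≤ B := fun p hp =>
    abs_Qf_le h0.le h1 hC hP (hVB p hp)
  have hB2 : 2 * C / (1 - γ) = 2 * B := by rw [hBdef]; ring
  -- Consequences of the gap being attained at a suboptimal action.
  obtain ⟨s₁, a₁, hne₁, hΔ₁⟩ := hΔmem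
  have hQminle : ∀ s a, Qmin (Qf γ c P (V πstar)) s ≤ Qf γ c P (V πstar) s a := fun s a =>
    Finset.inf'_le _ (Finset.mem_univ a)
  have hgreedy : ∀ s, ∃ a, Qf γ c P (V πstar) s a = Qmin (Qf γ c P (V πstar)) s := fun s => by
    obtain ⟨a, -, ha⟩ := Finset.exists_mem_eq_inf' Finset.univ_nonempty (Qf γ c P (V πstar) s)
    exact ⟨a, ha.symm⟩
  choose g hg using hgreedy
  have hΔpos : 0 < Δ := by
    rw [hΔ₁, sub_pos]
    exact lt_of_le_of_ne (hQminle s₁ a₁) hne₁.symm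
  have hΔB : Δ ≤ 2 * B := by
    rw [hΔ₁, ← hg s₁]
    have e1 := (abs_le.1 (hQB πstar hπstar s₁ a₁)).2
    have e2 := (abs_le.1 (hQB πstar hπstar s₁ (g s₁))).1
    linarith
  have hLpos : 0 < L := by
    refine Real.log_pos ?_
    have : 1 < Fintype.card A := Fintype.one_lt_card_iff.2
      ⟨a₁, g s₁, fun h => hne₁ (by rw [h, hg])⟩
    exact_mod_cast this
  -- The mismatch ratio dominates the transition kernel.
  have hϱP : ∀ s a s', γ * P s a s' ≤ ϱ * ν s' := fun s a s' => by
    have e1 := Finset.le_sup' (fun x : S × A × S => P x.1 x.2.1 x.2.2 / ν x.2.2)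
      (Finset.mem_univ (s, a, s'))
    rw [div_le_iff₀ (hνpos _)] at e1
    rw [hϱ, mul_assoc]
    exact mul_le_mul_of_nonneg_left e1 h0.le
  have hϱpos : 0 < ϱ := by
    have e1 := Finset.sum_le_sum fun s' (_ : s' ∈ Finset.univ) => hϱP s₁ a₁ s'
    rw [← Finset.mul_sum, ← Finset.mul_sum, (hP s₁ a₁).2, hν.2] at e1
    linarith
  -- Closed form and three-point identity of the iteration.
  have hη0 : ∀ k, 0 < η k := fun k => by rw [hηdef]; exact zpow_pos h0 _
  have hpos : ∀ k s a, 0 < π k s a := by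
    intro k
    induction k with
    | zero => intro s a; rw [hinit]; positivity
    | succ k ih =>
      intro s
      exact (minimizer_spec h0 (hparam k) (hinit s) (ih s) (hpol (k + 1) s) (hstep k s)).1
  have hspec := fun k s =>
    minimizer_spec h0 (hparam k) (hinit s) (hpos k s) (hpol (k + 1) s) (hstep k s)
  -- Linear convergence of the averaged value gap.
  have hηinv : ∀ k, 1 / η k = γ ^ (2 * k + 2) := fun k => by
    rw [hηdef, one_div, zpow_neg, inv_inv, ← zpow_natCast]
    congr 1
  have hηγinv : ∀ k, 1 / (η k * γ) = γ ^ (2 * k + 1) := fun k => by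
    rw [← div_div, hηinv, pow_succ, mul_div_assoc, div_self h0.ne', mul_one]
  have hτ : ∀ k, τ k = γ ^ (2 * k + 1) * (1 - γ) := fun k => by
    have e1 : τ k = (1 / γ - 1) * (1 / η k) := by
      rw [← hparam k]
      field_simp [(hη0 k).ne']
      ring
    rw [e1, hηinv, pow_succ]
    field_simp
  have hgap0 : ∀ k s, 0 ≤ V (π k) s - V πstar s := fun k s =>
    sub_nonneg.2 (hoptimal _ (hpol k) s)
  set F : ℕ → ℝ := fun k => ∑ s, ν s * (V (π k) s - V πstar s) with hFdef
  set K : ℕ → ℝ := fun k => ∑ s, ν s * KL (πstar s) (π k s) with hKdef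
  have hKnn : ∀ k, 0 ≤ K k := fun k => Finset.sum_nonneg fun s _ =>
    mul_nonneg (hν.1 s) (KL_nonneg (hπstar s) (hpol k s) (hpos k s))
  have hFstep : ∀ k, F (k + 1) ≤ γ * F k + γ ^ (2 * k + 1) * L + γ ^ (2 * k + 2) * K k
      - γ ^ (2 * k + 1) * K (k + 1) := by
    intro k
    have hpt : ∀ s, V (π (k + 1)) s - V πstar s ≤
        γ * ∑ a, πstar s a * ∑ s', P s a s' * (V (π k) s' - V πstar s')
          + γ ^ (2 * k + 1) * L + γ ^ (2 * k + 2) * KL (πstar s) (π k s)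
          - γ ^ (2 * k + 1) * KL (πstar s) (π (k + 1) s) := by
      intro s
      have e1 := value_step_le (L := L) h0 h1 (hη0 k)
        (by rw [hτ]; positivity) hP (fun s => hpol 0 s) (hpos 0)
        (fun s x hx => KL_uniform_le_log_card hx (hinit s)) (hpol k) (hpol (k + 1)) (hpos k)
        (hpos (k + 1)) (hV _ (hpol k)) (hV _ (hpol (k + 1))) (fun s => (hspec k s).2.2) s (hπstar s)
      have e2 := sum_mul_Qf_sub (γ := γ) (c := c) (P := P) (V (π k)) (V πstar) (πstar s) s
      rw [← hV πstar hπstar s] at e2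
      have e3 : τ k * L / (1 - γ) = γ ^ (2 * k + 1) * L := by
        rw [hτ]
        field_simp
      rw [hηinv, hηγinv, e3] at e1
      linarith
    calc F (k + 1) ≤ ∑ s, ν s * (γ * ∑ a, πstar s a * ∑ s', P s a s' * (V (π k) s' - V πstar s')
          + γ ^ (2 * k + 1) * L + γ ^ (2 * k + 2) * KL (πstar s) (π k s)
          - γ ^ (2 * k + 1) * KL (πstar s) (π (k + 1) s)) :=
        Finset.sum_le_sum fun s _ => mul_le_mul_of_nonneg_left (hpt s) (hν.1 s)
      _ = γ * (∑ s, ν s * ∑ a, πstar s a * ∑ s', P s a s' * (V (π k) s' - V πstar s'))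
          + γ ^ (2 * k + 1) * L * ∑ s, ν s + γ ^ (2 * k + 2) * K k
          - γ ^ (2 * k + 1) * K (k + 1) := by
        simp only [hKdef]
        rw [Finset.mul_sum Finset.univ _ γ, Finset.mul_sum Finset.univ _ (γ ^ (2 * k + 1) * L),
          Finset.mul_sum Finset.univ _ (γ ^ (2 * k + 2)), Finset.mul_sum Finset.univ _ (γ ^ (2 * k + 1))]
        rw [← Finset.sum_add_distrib, ← Finset.sum_add_distrib, ← Finset.sum_sub_distrib]
        exact Finset.sum_congr rfl fun s _ => by ring
      _ = _ := by rw [stationary_average hνstat, hν.2, mul_one]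
  have hFdecay : ∀ k, F k ≤ γ ^ k * (2 * (C + 4 * L) / (1 - γ)) := by
    intro k
    have e1 := linear_decay_of_recursion h0 h1 hKnn hFstep k
    have e2 : F 0 ≤ 2 * B := hν.sum_mul_le fun s => by
      have := (abs_le.1 (hVB _ (hpol 0) s)).2
      have := (abs_le.1 (hVB _ hπstar s)).1
      linarith
    have e3 : K 0 ≤ L := hν.sum_mul_le fun s => KL_uniform_le_log_card (hπstar s) (hinit s)
    have e4 : γ * K 0 ≤ L := (mul_le_of_le_one_left (hKnn 0) h1.le).trans e3
    have e5 : L * ((1 - γ ^ k) / (1 - γ)) ≤ L / (1 - γ) := by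
      rw [← mul_div_assoc]
      refine div_le_div_of_nonneg_right ?_ h1'.le
      have := pow_pos h0 k
      nlinarith
    have e6 : L ≤ L / (1 - γ) := by rw [le_div_iff₀ h1']; nlinarith
    have e7 : 2 * (C + 4 * L) / (1 - γ) = 2 * B + 8 * (L / (1 - γ)) := by rw [hBdef]; ring
    have e8 : 0 ≤ γ ^ (2 * k + 1) * K k := mul_nonneg (pow_pos h0 _).le (hKnn k)
    have e9 : 0 < L / (1 - γ) := by positivity
    calc F k ≤ γ ^ k * (F 0 + γ * K 0 + L * ((1 - γ ^ k) / (1 - γ))) := by linarith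
      _ ≤ _ := mul_le_mul_of_nonneg_left (by linarith) (pow_pos h0 k).le
  -- Action gaps along the iteration.
  set H : ℝ := ϱ * (C + 4 * L) / (1 - γ) with hHdef
  have hHpos : 0 < H := by positivity
  intro k hk
  set θ : ℝ := Δ * (1 - γ) / (2 * ϱ * (4 * L + C)) with hθdef
  have hθpos : 0 < θ := by positivity
  have hΔθ : Δ = 2 * θ * H := by
    rw [hθdef, hHdef, add_comm C]
    field_simp
  have hkθ : γ ^ k ≤ θ ^ 3 := by
    rw [← Real.log_le_log_iff (by positivity) (by positivity), Real.log_pow, Real.log_pow]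
    rw [← mul_div_assoc, div_le_iff_of_neg (Real.log_neg h0 h1)] at hk
    exact_mod_cast hk
  set E : ℝ := Real.exp (2 * C / ((1 - γ ^ 3) * (1 - γ) * γ)) *
    Real.exp (-(Δ * γ ^ (-(2 * (k : ℤ) + 1)) / 2)) with hEdef
  have hbad : ∀ s a, Qf γ c P (V πstar) s a ≠ Qmin (Qf γ c P (V πstar)) s →
      π (k + 1) s a ≤ E := by
    intro s a ha
    set D : ℕ → ℝ := fun i => Qf γ c P (V (π i)) s a - Qf γ c P (V (π i)) s (g s) with hDdef
    have hΔle : Δ ≤ Qf γ c P (V πstar) s a - Qf γ c P (V πstar) s (g s) := by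
      rw [hg]
      exact hΔlb s a ha
    have hDsub : ∀ i, D i = Qf γ c P (V πstar) s a - Qf γ c P (V πstar) s (g s)
        + γ * ∑ s', P s a s' * (V (π i) s' - V πstar s')
        - γ * ∑ s', P s (g s) s' * (V (π i) s' - V πstar s') := fun i => by
      rw [← Qf_sub_Qf (c := c), ← Qf_sub_Qf (c := c)]
      simp only [hDdef]
      ring
    have hDneg : ∀ i, -(2 * C / (1 - γ)) ≤ D i := fun i => by
      have e1 := (abs_le.1 (hQB _ (hpol i) s a)).1
      have e2 := (abs_le.1 (hQB _ (hpol i) s (g s))).2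
      simp only [hDdef]
      linarith
    have hDlin : ∀ i, 2 * H * (θ - γ ^ i) ≤ D i := fun i => by
      have e1 : 0 ≤ γ * ∑ s', P s a s' * (V (π i) s' - V πstar s') :=
        mul_nonneg h0.le ((hP s a).le_sum_mul (hgap0 i))
      have e2 : γ * ∑ s', P s (g s) s' * (V (π i) s' - V πstar s') ≤ ϱ * F i := by
        rw [Finset.mul_sum, hFdef, Finset.mul_sum]
        refine Finset.sum_le_sum fun s' _ => ?_
        rw [← mul_assoc, ← mul_assoc]
        exact mul_le_mul_of_nonneg_right (hϱP s (g s) s') (hgap0 i s')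
      have e3 := mul_le_mul_of_nonneg_left (hFdecay i) hϱpos.le
      have e4 : ϱ * (γ ^ i * (2 * (C + 4 * L) / (1 - γ))) = 2 * H * γ ^ i := by
        rw [hHdef]; ring
      rw [hDsub]
      linarith
    have hDmid : ∀ i, H * (2 * θ - 1) ≤ D i := fun i => by
      have e1 : ∑ s', γ * (P s (g s) s' - P s a s') * (V (π i) s' - V πstar s' - B) ≤
          ∑ s', ϱ * ν s' * B := by
        refine Finset.sum_le_sum fun s' _ => ?_
        have e2 : |γ * (P s (g s) s' - P s a s')| ≤ ϱ * ν s' := by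
          have := mul_nonneg h0.le ((hP s a).1 s')
          have := mul_nonneg h0.le ((hP s (g s)).1 s')
          have := hϱP s a s'
          have := hϱP s (g s) s'
          rw [abs_le]
          constructor <;> linarith
        have e3 : |V (π i) s' - V πstar s' - B| ≤ B := by
          have := hgap0 i s'
          have := (abs_le.1 (hVB _ (hpol i) s')).2
          have := (abs_le.1 (hVB _ hπstar s')).1
          rw [abs_le]
          constructor <;> linarith
        refine (le_abs_self _).trans ?_
        rw [abs_mul]
        exact mul_le_mul e2 e3 (abs_nonneg _) ((abs_nonneg _).trans e2)
      have e4 : ∑ s', γ * (P s (g s) s' - P s a s') * (V (π i) s' - V πstar s' - B) =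
          γ * ∑ s', P s (g s) s' * (V (π i) s' - V πstar s')
            - γ * ∑ s', P s a s' * (V (π i) s' - V πstar s')
            - γ * B * ∑ s', P s (g s) s' + γ * B * ∑ s', P s a s' := by
        simp only [Finset.mul_sum]
        rw [← Finset.sum_sub_distrib, ← Finset.sum_sub_distrib, ← Finset.sum_add_distrib]
        exact Finset.sum_congr rfl fun s' _ => by ring
      rw [e4, (hP s (g s)).2, (hP s a).2, ← Finset.sum_mul, ← Finset.mul_sum, hν.2] at e1
      have e5 : ϱ * 1 * B ≤ H := by
        rw [hBdef, hHdef, mul_one, ← mul_div_assoc]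
        exact div_le_div_of_nonneg_right
          (mul_le_mul_of_nonneg_left (by linarith) hϱpos.le) h1'.le
      rw [hDsub]
      linarith
    have hbound := log_ratio_lower_bound (k := k) h0 h1 hHpos hθpos hC0
      (by rw [← hΔθ, hB2]; exact hΔB) hkθ hDmid hDlin hDneg
      (R := fun i => Real.log (π i s (g s)) - Real.log (π i s a))
      (by simp only [hinit, sub_self])
      (fun i => by
        have e1 := (hspec i s).2.1 (g s) a
        have e2 : γ * η i = γ ^ (-(2 * (i : ℤ) + 1)) := by
          rw [hηdef, ← zpow_one_add₀ h0.ne']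
          rw [show (1 : ℤ) + -(2 * ((i : ℤ) + 1)) = -(2 * (i : ℤ) + 1) by ring]
        rw [e2] at e1
        simp only [hDdef]
        linarith)
    have e1 : Real.log (π (k + 1) s (g s)) ≤ 0 :=
      Real.log_nonpos (hpos _ _ _).le ((hpol (k + 1) s).le_one _)
    rw [hEdef, ← Real.exp_add, ← Real.log_le_iff_le_exp (hpos _ _ _)]
    have e2 : Δ * γ ^ (-(2 * (k : ℤ) + 1)) / 2 = γ ^ (-(2 * (k : ℤ) + 1)) * (θ * H) := by
      rw [hΔθ]; ring
    rw [e2]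
    linarith
  -- Move the mass of the suboptimal actions onto optimal ones.
  have hE0 : 0 ≤ E := by positivity
  choose r hrd hrsupp hrdist using fun s => exists_dist_supported
    (G := fun a => Qf γ c P (V πstar) s a = Qmin (Qf γ c P (V πstar)) s) (hg s)
    (hpol (k + 1) s) hE0 (hbad s)
  have hropt : IsOptPolicy V r := isOptPolicy_of_greedy h0.le h1 hP hV hopt hrd hrsupp
  refine Finset.sup'_le _ _ fun s _ => ?_
  have hbdd : BddBelow {x : ℝ | ∃ π', IsOptPolicy V π' ∧ x = ∑ a, |π (k + 1) s a - π' s a|} :=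
    ⟨0, by
      rintro x ⟨p, -, rfl⟩
      exact Finset.sum_nonneg fun a _ => abs_nonneg _⟩
  exact (csInf_le hbdd ⟨r, hropt, rfl⟩).trans ((hrdist s).trans_eq (by rw [hEdef]; ring))
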